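/- Let Ω ⊂ ℝ^N be an open bounded set, α, β ∈ L²(Ω), and e¹_α, e¹_β, e²_α, e²_β ∈ L∞(Ω) with α + eⁱ_α ≤ β + eⁱ_β a.e. on Ω for i = 1, 2. Then for every u₁ ∈ U_ad(e₁) there exists u₂ ∈ U_ad(e₂) such that |u₁(x) − u₂(x)| ≤ |e¹_α(x) − e²_α(x)| + |e¹_β(x) − e²_β(x)| for a.e. x ∈ Ω; in particular, u₁ − u₂ ∈ L∞(Ω) with ‖u₁ − u₂‖_{L∞(Ω)} ≤ ‖e¹_α − e²_α‖_{L∞(Ω)} + ‖e¹_β − e²_β‖_{L∞(Ω)} and ‖u₁ − u₂‖_{L²(Ω)} ≤ |Ω|^{1/2} (‖e¹_α − e²_α‖_{L∞(Ω)} + ‖e¹_β − e²_β‖_{L∞(Ω)}), where |Ω| denotes the Lebesgue measure of Ω. Specifically, if λ : Ω → [0,1] is measurable with u₁ = λ(α + e¹_α) + (1 − λ)(β + e¹_β) a.e. on Ω, then u₂ := λ(α + e²_α) + (1 − λ)(β + e²_β) has these properties, and such a λ exists. -/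

import Mathlib

noncomputable section

open MeasureTheory

/-- The perturbed admissible control set
`U_ad(e) = {u ∈ L²(Ω) : a ≤ u ≤ b a.e.}`, with bounds `a = α + e_α`, `b = β + e_β`. -/
def Uad {N : ℕ} (Ω : Set (EuclideanSpace ℝ (Fin N)))
    (a b : EuclideanSpace ℝ (Fin N) → ℝ) : Set (Lp ℝ 2 (volume.restrict Ω)) :=
  {u | ∀ᵐ x ∂(volume.restrict Ω), a x ≤ u x ∧ u x ≤ b x}

theorem ae_abs_sub_le_norm_sub {X : Type*} [MeasurableSpace X] {μ : Measure X}
    (f g : Lp ℝ ⊤ μ) : ∀ᵐ x ∂μ, |f x - g x| ≤ ‖f - g‖ := by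
  have h : ∀ᵐ x ∂μ, ‖(f - g) x‖ₑ ≤ eLpNorm (⇑(f - g)) ⊤ μ := by
    rw [eLpNorm_exponent_top]
    exact ae_le_eLpNormEssSup
  filter_upwards [h, Lp.coeFn_sub f g] with x hx hsub
  have hx' := ENNReal.toReal_mono (Lp.eLpNorm_ne_top (f - g)) hx
  rw [← Lp.norm_def, toReal_enorm, hsub, Pi.sub_apply, Real.norm_eq_abs] at hx'
  exact hx'

/-- The weight of `a` in the representation of `u ∈ [a, b]` as a convex combination of `a`
and `b`, truncated to `[0, 1]`. -/
def convexWeight (a b u : ℝ) : ℝ := max 0 (min 1 ((b - u) / (b - a)))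

theorem convexWeight_mem_Icc (a b u : ℝ) : convexWeight a b u ∈ Set.Icc (0 : ℝ) 1 :=
  ⟨le_max_left _ _, max_le zero_le_one (min_le_left _ _)⟩

theorem eq_convexWeight_combination {a b u : ℝ} (ha : a ≤ u) (hb : u ≤ b) :
    u = convexWeight a b u * a + (1 - convexWeight a b u) * b := by
  rcases (ha.trans hb).eq_or_lt with h | h
  · subst h
    linarith
  · have hpos : 0 < b - a := sub_pos.2 h
    have h0 : 0 ≤ (b - u) / (b - a) := div_nonneg (sub_nonneg.2 hb) hpos.le
    have h1 : (b - u) / (b - a) ≤ 1 := (div_le_one hpos).2 (by linarith)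
    rw [convexWeight, min_eq_right h1, max_eq_right h0]
    field_simp
    ring

theorem abs_convex_combination_le {t : ℝ} (ht : t ∈ Set.Icc (0 : ℝ) 1) (p q : ℝ) :
    |t * p + (1 - t) * q| ≤ |p| + |q| := by
  have ht' : 0 ≤ 1 - t := sub_nonneg.2 ht.2
  calc |t * p + (1 - t) * q| ≤ |t * p| + |(1 - t) * q| := abs_add_le _ _
    _ = t * |p| + (1 - t) * |q| := by
      rw [abs_mul, abs_mul, abs_of_nonneg ht.1, abs_of_nonneg ht']
    _ ≤ |p| + |q| := by nlinarith [abs_nonneg p, abs_nonneg q, ht.1, ht.2]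

/-- for every `u₁ ∈ U_ad(e₁)` there is `u₂ ∈ U_ad(e₂)` with
`|u₁ − u₂| ≤ |e¹_α − e²_α| + |e¹_β − e²_β|` a.e., hence with the corresponding
`L∞` and `L²` estimates; moreover `u₂` can be taken of the form
`u₂ = λ(α + e²_α) + (1 − λ)(β + e²_β)` where `λ : Ω → [0,1]` is measurable and
`u₁ = λ(α + e¹_α) + (1 − λ)(β + e¹_β)` a.e., and such a `λ` exists. -/
theorem stmt8 {N : ℕ} (Ω : Set (EuclideanSpace ℝ (Fin N)))
    (hΩo : IsOpen Ω) (hΩb : Bornology.IsBounded Ω)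
    (α β : Lp ℝ 2 (volume.restrict Ω))
    (eα₁ eβ₁ eα₂ eβ₂ : Lp ℝ ⊤ (volume.restrict Ω))
    (h₁ : ∀ᵐ x ∂(volume.restrict Ω), α x + eα₁ x ≤ β x + eβ₁ x)
    (h₂ : ∀ᵐ x ∂(volume.restrict Ω), α x + eα₂ x ≤ β x + eβ₂ x)
    (u₁ : Lp ℝ 2 (volume.restrict Ω))
    (hu₁ : u₁ ∈ Uad Ω (fun x => α x + eα₁ x) (fun x => β x + eβ₁ x)) :
    ∃ u₂ ∈ Uad Ω (fun x => α x + eα₂ x) (fun x => β x + eβ₂ x),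
      (∀ᵐ x ∂(volume.restrict Ω),
        |u₁ x - u₂ x| ≤ |eα₁ x - eα₂ x| + |eβ₁ x - eβ₂ x|) ∧
      eLpNorm (⇑(u₁ - u₂)) ⊤ (volume.restrict Ω) ≤
        ENNReal.ofReal (‖eα₁ - eα₂‖ + ‖eβ₁ - eβ₂‖) ∧
      ‖u₁ - u₂‖ ≤ Real.sqrt ((volume Ω).toReal) * (‖eα₁ - eα₂‖ + ‖eβ₁ - eβ₂‖) ∧
      ∃ lam : EuclideanSpace ℝ (Fin N) → ℝ, Measurable lam ∧
        (∀ x, lam x ∈ Set.Icc (0:ℝ) 1) ∧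
        (∀ᵐ x ∂(volume.restrict Ω),
          u₁ x = lam x * (α x + eα₁ x) + (1 - lam x) * (β x + eβ₁ x)) ∧
        (∀ᵐ x ∂(volume.restrict Ω),
          u₂ x = lam x * (α x + eα₂ x) + (1 - lam x) * (β x + eβ₂ x)) := by
  have hfin : IsFiniteMeasure (volume.restrict Ω) :=
    isFiniteMeasure_restrict.2 hΩb.measure_lt_top.ne
  have hmeas {p : ENNReal} (f : Lp ℝ p (volume.restrict Ω)) : Measurable f :=
    (Lp.stronglyMeasurable f).measurable
  have hadd (f : Lp ℝ 2 (volume.restrict Ω)) (g : Lp ℝ ⊤ (volume.restrict Ω)) :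
      MemLp (fun x => f x + g x) 2 (volume.restrict Ω) :=
    (Lp.memLp f).add ((Lp.memLp g).mono_exponent le_top)
  let lam : EuclideanSpace ℝ (Fin N) → ℝ :=
    fun x => convexWeight (α x + eα₁ x) (β x + eβ₁ x) (u₁ x)
  have hlam : ∀ x, lam x ∈ Set.Icc (0 : ℝ) 1 := fun x => convexWeight_mem_Icc _ _ _
  have hlam_meas : Measurable lam :=
    measurable_const.max (measurable_const.min
      ((((hmeas β).add (hmeas eβ₁)).sub (hmeas u₁)).div
        (((hmeas β).add (hmeas eβ₁)).sub ((hmeas α).add (hmeas eα₁)))))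
  let v : EuclideanSpace ℝ (Fin N) → ℝ :=
    fun x => lam x * (α x + eα₂ x) + (1 - lam x) * (β x + eβ₂ x)
  have hv_meas : Measurable v :=
    (hlam_meas.mul ((hmeas α).add (hmeas eα₂))).add
      ((measurable_const.sub hlam_meas).mul ((hmeas β).add (hmeas eβ₂)))
  have hv : MemLp v 2 (volume.restrict Ω) := by
    refine ((hadd α eα₂).norm.add (hadd β eβ₂).norm).of_le hv_meas.aestronglyMeasurable
      (Filter.Eventually.of_forall fun x => ?_)
    exact (abs_convex_combination_le (hlam x) _ _).trans (le_abs_self _)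
  have hu : ∀ᵐ x ∂(volume.restrict Ω), u₁ x = lam x * (α x + eα₁ x) + (1 - lam x) * (β x + eβ₁ x) := by
    filter_upwards [hu₁] with x hx
    exact eq_convexWeight_combination hx.1 hx.2
  have hdiff : ∀ᵐ x ∂(volume.restrict Ω), |u₁ x - hv.toLp v x| ≤ |eα₁ x - eα₂ x| + |eβ₁ x - eβ₂ x| := by
    filter_upwards [hu, hv.coeFn_toLp] with x hx hvx
    have : u₁ x - v x = lam x * (eα₁ x - eα₂ x) + (1 - lam x) * (eβ₁ x - eβ₂ x) := by
      rw [hx]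
      ring
    rw [hvx, this]
    exact abs_convex_combination_le (hlam x) _ _
  have hbound : ∀ᵐ x ∂(volume.restrict Ω), ‖(u₁ - hv.toLp v) x‖ ≤ ‖eα₁ - eα₂‖ + ‖eβ₁ - eβ₂‖ := by
    filter_upwards [hdiff, Lp.coeFn_sub u₁ (hv.toLp v), ae_abs_sub_le_norm_sub eα₁ eα₂,
      ae_abs_sub_le_norm_sub eβ₁ eβ₂] with x hx hsub hα hβ
    rw [hsub, Pi.sub_apply, Real.norm_eq_abs]
    exact hx.trans (add_le_add hα hβ)
  refine ⟨hv.toLp v, ?_, hdiff, ?_, ?_, lam, hlam_meas, hlam, hu, hv.coeFn_toLp⟩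
  · filter_upwards [h₂, hv.coeFn_toLp] with x hx hvx
    rw [hvx]
    obtain ⟨h0, h1⟩ := hlam x
    constructor <;> simp only [v] <;> nlinarith
  · rw [eLpNorm_exponent_top]
    exact eLpNormEssSup_le_of_ae_bound hbound
  · have h := Lp.norm_le_of_ae_bound (add_nonneg (norm_nonneg _) (norm_nonneg _)) hbound
    refine h.trans_eq ?_
    congr 1
    simp [Real.sqrt_eq_rpow, measureUnivNNReal, ENNReal.coe_toNNReal_eq_toReal]
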